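/- Let k ≥ 1, let γ : Fin k → I, let i ∈ J, and let m be an integer with m ≥ 0. Then for every (r,s) ∈ ℤ^k × ℤ with r(0)+⋯+r(k−1)+s = m, the element (a*(γ(0),r(0))⋯a*(γ(k−1),r(k−1))·u_n) ⊗ (b(i,s)·v_n) of M_n ⊗_ℂ π(Λ) is zero; in particular this family has finite support and sums to 0. (By linearity this is Lemma: for any polynomial R in the fields a*_γ(z) with no constant term, [R(a*(z)) b_i(z)]_m annihilates the vacuum vector w_n = u_n ⊗ v_n for all m ≥ 0.) -/

import Mathlib

noncomputable section

/-- Generators of the infinite-dimensional Weyl algebra: `a γ r` and `as γ r`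
(the latter playing the role of `a*(γ,r)`), for `γ ∈ I`, `r ∈ ℤ`. -/
inductive WGen (I : Type) : Type
  | a : I → ℤ → WGen I
  | as : I → ℤ → WGen I

open FreeAlgebra in
/-- The defining relations of the infinite-dimensional Weyl algebra `𝒜`:
`a(γ,r)·a*(δ,s) − a*(δ,s)·a(γ,r) = (1 if γ = δ and r = −s, else 0)`, while the `a`'s
commute among themselves and the `a*`'s commute among themselves. -/
inductive WeylRel (I : Type) : FreeAlgebra ℂ (WGen I) → FreeAlgebra ℂ (WGen I) → Prop
  | a_as_eq (γ : I) (r : ℤ) :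
      WeylRel I (ι ℂ (WGen.a γ r) * ι ℂ (WGen.as γ (-r)))
        (ι ℂ (WGen.as γ (-r)) * ι ℂ (WGen.a γ r) + 1)
  | a_as_ne (γ δ : I) (r s : ℤ) (h : γ ≠ δ ∨ r ≠ -s) :
      WeylRel I (ι ℂ (WGen.a γ r) * ι ℂ (WGen.as δ s))
        (ι ℂ (WGen.as δ s) * ι ℂ (WGen.a γ r))
  | a_a (γ δ : I) (r s : ℤ) :
      WeylRel I (ι ℂ (WGen.a γ r) * ι ℂ (WGen.a δ s))
        (ι ℂ (WGen.a δ s) * ι ℂ (WGen.a γ r))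
  | as_as (γ δ : I) (r s : ℤ) :
      WeylRel I (ι ℂ (WGen.as γ r) * ι ℂ (WGen.as δ s))
        (ι ℂ (WGen.as δ s) * ι ℂ (WGen.as γ r))

/-- The infinite-dimensional Weyl algebra `𝒜`: the quotient of the free ℂ-algebra on
the generators `a(γ,r)`, `a*(γ,r)` by the two-sided ideal generated by the relations. -/
abbrev WeylAlg (I : Type) : Type := RingQuot (WeylRel I)

/-- The generator `a(γ,r)` of `𝒜`. -/
def wa {I : Type} (γ : I) (r : ℤ) : WeylAlg I :=
  RingQuot.mkAlgHom ℂ (WeylRel I) (FreeAlgebra.ι ℂ (WGen.a γ r))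

/-- The generator `a*(γ,r)` of `𝒜`. -/
def was {I : Type} (γ : I) (r : ℤ) : WeylAlg I :=
  RingQuot.mkAlgHom ℂ (WeylRel I) (FreeAlgebra.ι ℂ (WGen.as γ r))

/-- The left ideal of `𝒜` generated by the `a(γ,r)` with `r ≥ n` and the
`a*(γ,r)` with `r ≥ 1 − n`. -/
def fockIdeal (I : Type) (n : ℕ) : Submodule (WeylAlg I) (WeylAlg I) :=
  Submodule.span (WeylAlg I)
    ({x | ∃ γ : I, ∃ r : ℤ, (n : ℤ) ≤ r ∧ x = wa γ r} ∪
     {x | ∃ γ : I, ∃ r : ℤ, 1 - (n : ℤ) ≤ r ∧ x = was γ r})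

/-- The Fock module `M_n = 𝒜 / 𝒜·(a(γ,r) : r ≥ n, a*(γ,r) : r ≥ 1−n)`,
a left `𝒜`-module. -/
abbrev Fock (I : Type) (n : ℕ) : Type := WeylAlg I ⧸ fockIdeal I n

/-- The vacuum vector `u_n ∈ M_n`, the image of `1 ∈ 𝒜`. -/
def fockVac (I : Type) (n : ℕ) : Fock I n := Submodule.Quotient.mk 1



/-- A symmetric complex-valued function on `J × J`. -/
structure SymForm (J : Type) where
  toFun : J → J → ℂ
  symm : ∀ i j, toFun i j = toFun j i

/-- The structure constant of the Heisenberg bracket: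
`[b(i,r), b(j,s)] = −r·B(i,j)·𝟙` when `s = −r`, and `0` otherwise. -/
def heisCoef {J : Type} (B : SymForm J) (p q : J × ℤ) : ℂ :=
  if q.2 = -p.2 then (-(p.2 : ℂ)) * B.toFun p.1 q.1 else 0

lemma heisCoef_skew {J : Type} (B : SymForm J) (p q : J × ℤ) :
    heisCoef B p q = -heisCoef B q p := by
  unfold heisCoef
  by_cases h : q.2 = -p.2
  · have h' : p.2 = -q.2 := by omega
    rw [if_pos h, if_pos h']
    have hc : ((q.2 : ℤ) : ℂ) = -((p.2 : ℤ) : ℂ) := by rw [h]; push_cast; ring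
    rw [B.symm p.1 q.1]
    rw [show (-(q.2 : ℂ)) = (p.2 : ℂ) by rw [hc]; ring]
    ring
  · have h' : ¬ p.2 = -q.2 := by omega
    rw [if_neg h, if_neg h']
    ring

/-- The Heisenberg Lie algebra `H`: the ℂ-vector space with basis
`{b(i,r) : i ∈ J, r ∈ ℤ} ∪ {𝟙}`, realized as `((J × ℤ) →₀ ℂ) × ℂ`
(first component: coordinates in the `b(i,r)`'s; second: coefficient of `𝟙`). -/
def Heis (J : Type) (_B : SymForm J) : Type := ((J × ℤ) →₀ ℂ) × ℂ

variable {J : Type} {B : SymForm J}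

instance : AddCommGroup (Heis J B) := inferInstanceAs (AddCommGroup (((J × ℤ) →₀ ℂ) × ℂ))
instance : Module ℂ (Heis J B) := inferInstanceAs (Module ℂ (((J × ℤ) →₀ ℂ) × ℂ))

lemma heis_add_fst (x y : Heis J B) : (x + y).1 = x.1 + y.1 := rfl
lemma heis_add_snd (x y : Heis J B) : (x + y).2 = x.2 + y.2 := rfl
lemma heis_smul_fst (t : ℂ) (x : Heis J B) : (t • x).1 = t • x.1 := rfl

/-- The bracket on `H`, determined by `[b(i,r), b(j,s)] = −r·B(i,j)·𝟙` if `r = −s`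
and `0` otherwise, with `𝟙` central. -/
instance : Bracket (Heis J B) (Heis J B) :=
  ⟨fun x y => (0, x.1.sum fun p c => y.1.sum fun q d => c * d * heisCoef B p q)⟩

lemma heis_bracket_def (x y : Heis J B) :
    ⁅x, y⁆ = ((0 : (J × ℤ) →₀ ℂ),
      x.1.sum fun p c => y.1.sum fun q d => c * d * heisCoef B p q) := rfl

lemma heis_bracket_fst (x y : Heis J B) : (⁅x, y⁆ : Heis J B).1 = 0 := rfl

lemma heis_bracket_snd (x y : Heis J B) :
    (⁅x, y⁆ : Heis J B).2 = x.1.sum fun p c => y.1.sum fun q d => c * d * heisCoef B p q := rfl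

instance : LieRing (Heis J B) where
  add_lie x y z := by
    refine Prod.ext ?_ ?_
    · rw [heis_bracket_fst, heis_add_fst, heis_bracket_fst, heis_bracket_fst, add_zero]
    · rw [heis_bracket_snd, heis_add_snd, heis_bracket_snd, heis_bracket_snd, heis_add_fst]
      rw [Finsupp.sum_add_index']
      · intro p
        simp
      · intro p c c'
        rw [← Finsupp.sum_add]
        exact Finsupp.sum_congr fun q _ => by ring
  lie_add x y z := by
    refine Prod.ext ?_ ?_
    · rw [heis_bracket_fst, heis_add_fst, heis_bracket_fst, heis_bracket_fst, add_zero]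
    · rw [heis_bracket_snd, heis_add_snd, heis_bracket_snd, heis_bracket_snd, heis_add_fst]
      rw [← Finsupp.sum_add]
      refine Finsupp.sum_congr fun p _ => ?_
      rw [Finsupp.sum_add_index']
      · intro q
        simp
      · intro q d d'
        ring
  lie_self x := by
    refine Prod.ext rfl ?_
    rw [heis_bracket_snd]
    show (x.1.sum fun p c => x.1.sum fun q d => c * d * heisCoef B p q) = (0 : Heis J B).2
    have h0 : ((0 : Heis J B)).2 = (0 : ℂ) := rfl
    rw [h0]
    have e1 : (x.1.sum fun p c => x.1.sum fun q d => c * d * heisCoef B p q)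
        = x.1.sum fun p c => x.1.sum fun q d => c * d * -heisCoef B q p :=
      Finsupp.sum_congr fun p _ => Finsupp.sum_congr fun q _ => by
        rw [heisCoef_skew B p q]
    have e2 : (x.1.sum fun p c => x.1.sum fun q d => c * d * -heisCoef B q p)
        = -(x.1.sum fun p c => x.1.sum fun q d => c * d * heisCoef B q p) := by
      rw [← Finsupp.sum_neg]
      exact Finsupp.sum_congr fun p _ => by
        rw [← Finsupp.sum_neg]
        exact Finsupp.sum_congr fun q _ => by ring
    have e3 : (x.1.sum fun p c => x.1.sum fun q d => c * d * heisCoef B q p)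
        = x.1.sum fun p c => x.1.sum fun q d => c * d * heisCoef B p q := by
      rw [Finsupp.sum_comm]
      exact Finsupp.sum_congr fun q _ => Finsupp.sum_congr fun p _ => by ring
    have h1 := e1.trans e2
    rw [e3] at h1
    have h2 : (2 : ℂ) * (x.1.sum fun p c => x.1.sum fun q d => c * d * heisCoef B p q) = 0 := by
      linear_combination h1
    rcases mul_eq_zero.mp h2 with h | h
    · exact absurd h two_ne_zero
    · exact h
  leibniz_lie x y z := by
    refine Prod.ext ?_ ?_
    · simp [heis_bracket_fst, heis_add_fst]
    · simp [heis_bracket_snd, heis_bracket_fst, heis_add_snd, Finsupp.sum_zero_index]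

instance : LieAlgebra ℂ (Heis J B) where
  lie_smul t x y := by
    refine Prod.ext ?_ ?_
    · rw [heis_bracket_fst, heis_smul_fst, heis_bracket_fst, smul_zero]
    · have hsnd : ((t • ⁅x, y⁆ : Heis J B)).2 = t * (⁅x, y⁆ : Heis J B).2 := rfl
      rw [heis_bracket_snd, hsnd, heis_bracket_snd, heis_smul_fst]
      have step1 : (x.1.sum fun p c => (t • y.1).sum fun q d => c * d * heisCoef B p q)
          = x.1.sum fun p c => y.1.sum fun q d => t * (c * d * heisCoef B p q) := by
        refine Finsupp.sum_congr fun p _ => ?_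
        rw [Finsupp.sum_smul_index (fun q => by ring)]
        exact Finsupp.sum_congr fun q _ => by ring
      rw [step1]
      have step2 : ∀ (f : (J × ℤ) →₀ ℂ) (g : J × ℤ → ℂ → ℂ),
          (f.sum fun a b => t * g a b) = t * f.sum g := by
        intro f g
        rw [Finsupp.sum, Finsupp.sum, Finset.mul_sum]
      calc (x.1.sum fun p c => y.1.sum fun q d => t * (c * d * heisCoef B p q))
          = x.1.sum fun p c => t * (y.1.sum fun q d => c * d * heisCoef B p q) :=
            Finsupp.sum_congr fun p _ => step2 y.1 _
        _ = t * x.1.sum fun p c => y.1.sum fun q d => c * d * heisCoef B p q := step2 x.1 _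

/-- The basis vector `b(i,r)` of the Heisenberg Lie algebra. -/
def heisB (B : SymForm J) (i : J) (r : ℤ) : Heis J B := (Finsupp.single (i, r) 1, 0)

/-- The central basis vector `𝟙` of the Heisenberg Lie algebra. -/
def heisOne (B : SymForm J) : Heis J B := (0, 1)

/-- The left ideal of `U(H)` generated by `𝟙 − 1` and the elements
`b(i,r) − Λ(i,r)·1` for `i ∈ J` and integers `r ≥ 0`. -/
def heisIdeal (B : SymForm J) (Λ : J → ℤ → ℂ) :
    Submodule (UniversalEnvelopingAlgebra ℂ (Heis J B))
      (UniversalEnvelopingAlgebra ℂ (Heis J B)) :=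
  Submodule.span (UniversalEnvelopingAlgebra ℂ (Heis J B))
    ({UniversalEnvelopingAlgebra.ι ℂ (heisOne B) - 1} ∪
     {x | ∃ i : J, ∃ r : ℤ, 0 ≤ r ∧
        x = UniversalEnvelopingAlgebra.ι ℂ (heisB B i r) -
              algebraMap ℂ (UniversalEnvelopingAlgebra ℂ (Heis J B)) (Λ i r)})

/-- The induced module `π(Λ) = U(H) / U(H)·(𝟙 − 1, b(i,r) − Λ(i,r) : r ≥ 0)`,
a left `U(H)`-module. -/
abbrev HeisMod (B : SymForm J) (Λ : J → ℤ → ℂ) : Type :=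
  UniversalEnvelopingAlgebra ℂ (Heis J B) ⧸ heisIdeal B Λ

/-- The vacuum vector `v_n ∈ π(Λ)`, the image of `1 ∈ U(H)`. -/
def heisVac (B : SymForm J) (Λ : J → ℤ → ℂ) : HeisMod B Λ :=
  Submodule.Quotient.mk 1


lemma was_commute {I : Type} (γ δ : I) (r s : ℤ) : Commute (was γ r) (was δ s) := by
  have h := RingQuot.mkAlgHom_rel ℂ (WeylRel.as_as γ δ r s)
  rw [map_mul, map_mul] at h
  exact h

lemma was_smul_fockVac {I : Type} {n : ℕ} (γ : I) {r : ℤ} (hr : 1 - (n : ℤ) ≤ r) :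
    was γ r • fockVac I n = 0 := by
  rw [fockVac, ← Submodule.Quotient.mk_smul, smul_eq_mul, mul_one,
    Submodule.Quotient.mk_eq_zero]
  exact Submodule.subset_span (Or.inr ⟨γ, r, hr, rfl⟩)

lemma list_prod_smul_eq_zero {R M : Type*} [Ring R] [AddCommGroup M] [Module R M]
    (l : List R) (hl : ∀ x ∈ l, ∀ y ∈ l, Commute x y) {x : R} (hx : x ∈ l) {v : M}
    (hv : x • v = 0) : l.prod • v = 0 := by
  induction l with
  | nil => simp at hx
  | cons y l ih =>
    rw [List.prod_cons]
    rcases List.mem_cons.mp hx with rfl | hx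
    · have hc : Commute x l.prod :=
        Commute.list_prod_right _ _ fun z hz => hl x (by simp) z (by simp [hz])
      rw [hc.eq, mul_smul, hv, smul_zero]
    · rw [mul_smul, ih (fun a ha b hb => hl a (by simp [ha]) b (by simp [hb])) hx, smul_zero]

lemma heisB_smul_heisVac {J : Type} {B : SymForm J} {Λ : J → ℤ → ℂ} (i : J) {s : ℤ}
    (hs : 0 ≤ s) (hΛ : Λ i s = 0) :
    UniversalEnvelopingAlgebra.ι ℂ (heisB B i s) • heisVac B Λ = 0 := by
  rw [heisVac, ← Submodule.Quotient.mk_smul, smul_eq_mul, mul_one,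
    Submodule.Quotient.mk_eq_zero]
  exact Submodule.subset_span (Or.inr ⟨i, s, hs, by rw [hΛ, map_zero, sub_zero]⟩)

open scoped TensorProduct

/-!
STATEMENT 7: for `k ≥ 1`, `γ : Fin k → I`, `i ∈ J` and any integer `m ≥ 0`, every term
`(a*(γ 0, r 0)⋯a*(γ (k−1), r (k−1))·u_n) ⊗ (b(i,s)·v_n)` of `M_n ⊗[ℂ] π(Λ)` with
`r 0 + ⋯ + r (k−1) + s = m` is zero; in particular this family has finite support and
sums to `0`.  (This is the lemma `[R(a*(z)) b_i(z)]_m · w_n = 0` for `m ≥ 0`, for every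
polynomial `R` in the fields `a*_γ(z)` with no constant term, where `w_n = u_n ⊗ v_n`.)
-/
theorem mixed_weyl_heisenberg_mode_on_vacuum
    (n : ℕ) (hn : 1 ≤ n) (I : Type) (J : Type) (B : SymForm J)
    (Λ : J → ℤ → ℂ) (hΛ : ∀ (i : J) (r : ℤ), (n : ℤ) ≤ r → Λ i r = 0)
    (k : ℕ) (hk : 1 ≤ k) (γ : Fin k → I) (i : J) (m : ℤ) (hm : 0 ≤ m) :
    (∀ (r : Fin k → ℤ) (s : ℤ), (∑ j, r j) + s = m →
      (((List.ofFn fun j => was (γ j) (r j)).prod • fockVac I n) ⊗ₜ[ℂ]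
        (UniversalEnvelopingAlgebra.ι ℂ (heisB B i s) • heisVac B Λ)
        : Fock I n ⊗[ℂ] HeisMod B Λ) = 0) ∧
    (Function.support (fun rs : (Fin k → ℤ) × ℤ =>
        if (∑ j, rs.1 j) + rs.2 = m then
          (((List.ofFn fun j => was (γ j) (rs.1 j)).prod • fockVac I n) ⊗ₜ[ℂ]
            (UniversalEnvelopingAlgebra.ι ℂ (heisB B i rs.2) • heisVac B Λ)
            : Fock I n ⊗[ℂ] HeisMod B Λ)
        else 0)).Finite ∧
    (∑ᶠ rs : (Fin k → ℤ) × ℤ,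
        (if (∑ j, rs.1 j) + rs.2 = m then
          (((List.ofFn fun j => was (γ j) (rs.1 j)).prod • fockVac I n) ⊗ₜ[ℂ]
            (UniversalEnvelopingAlgebra.ι ℂ (heisB B i rs.2) • heisVac B Λ)
            : Fock I n ⊗[ℂ] HeisMod B Λ)
         else 0)) = 0 := by
  have hzero : ∀ (r : Fin k → ℤ) (s : ℤ), (∑ j, r j) + s = m →
      (((List.ofFn fun j => was (γ j) (r j)).prod • fockVac I n) ⊗ₜ[ℂ]
        (UniversalEnvelopingAlgebra.ι ℂ (heisB B i s) • heisVac B Λ)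
        : Fock I n ⊗[ℂ] HeisMod B Λ) = 0 := by
    intro r s hrs
    by_cases h : ∃ j, 1 - (n : ℤ) ≤ r j
    · obtain ⟨j, hj⟩ := h
      rw [list_prod_smul_eq_zero _ _ (List.mem_ofFn.mpr ⟨j, rfl⟩) (was_smul_fockVac (γ j) hj),
        TensorProduct.zero_tmul]
      intro x hx y hy
      obtain ⟨a, rfl⟩ := List.mem_ofFn.mp hx
      obtain ⟨b, rfl⟩ := List.mem_ofFn.mp hy
      exact was_commute _ _ _ _
    · push Not at h
      have hsum : ∑ j, r j ≤ ∑ _j : Fin k, -(n : ℤ) :=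
        Finset.sum_le_sum fun j _ => by have := h j; omega
      have hkn : (n : ℤ) ≤ k * n := by
        exact_mod_cast Nat.le_mul_of_pos_left n hk
      have hs : (n : ℤ) ≤ s := by
        simp only [Finset.sum_const, Finset.card_univ, Fintype.card_fin, nsmul_eq_mul,
          mul_neg] at hsum
        linarith
      rw [heisB_smul_heisVac i (by omega) (hΛ i s hs), TensorProduct.tmul_zero]
  have hfun : (fun rs : (Fin k → ℤ) × ℤ =>
      if (∑ j, rs.1 j) + rs.2 = m then
        (((List.ofFn fun j => was (γ j) (rs.1 j)).prod • fockVac I n) ⊗ₜ[ℂ]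
          (UniversalEnvelopingAlgebra.ι ℂ (heisB B i rs.2) • heisVac B Λ)
          : Fock I n ⊗[ℂ] HeisMod B Λ)
      else 0) = fun _ => 0 := by
    funext rs
    split_ifs with h
    · exact hzero _ _ h
    · rfl
  refine ⟨hzero, ?_, ?_⟩
  · rw [hfun, Function.support_fun_zero]
    exact Set.finite_empty
  · rw [hfun, finsum_zero]

end
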